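/- Consistency implies identifiability: let Θ be a metric space (the parameter space), and for each sample size n ∈ ℕ and each θ ∈ Θ let P_θ^n be a probability measure on a measurable space Ω_n and θ̂_n : Ω_n → Θ a measurable estimator. Suppose the estimator is consistent: for every θ ∈ Θ, θ̂_n converges to θ in P_θ^n-probability as n → ∞ (i.e., for every ε > 0, P_θ^n(dist(θ̂_n, θ) > ε) → 0). Then θ is identifiable: for any two distinct values θ₁ ≠ θ₂ in Θ and any K ∈ ℕ there exists n ≥ K such that the pushforward law of θ̂_n under P_{θ₁}^n differs from the pushforward law of θ̂_n under P_{θ₂}^n. -/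

import Mathlib

open MeasureTheory

/-- Consistency implies identifiability: if, for every true parameter value `θ`, the
estimator `est n` converges to `θ` in `P θ n`-probability as the sample size `n → ∞`,
then for any two distinct parameter values `θ₁ ≠ θ₂` and any `K` there is a sample size
`n ≥ K` at which the law of the estimator under `θ₁` differs from its law under `θ₂`. -/
theorem identifiable_of_consistent
    {Θ : Type*} [MetricSpace Θ] [MeasurableSpace Θ] [BorelSpace Θ]
    (Ωn : ℕ → Type*) [∀ n, MeasurableSpace (Ωn n)]
    (P : Θ → (n : ℕ) → Measure (Ωn n)) [∀ θ n, IsProbabilityMeasure (P θ n)]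
    (est : (n : ℕ) → Ωn n → Θ) (hmeas : ∀ n, Measurable (est n))
    (hconsistent : ∀ θ : Θ, ∀ ε > (0 : ℝ),
      Filter.Tendsto (fun n => P θ n {ω | ε < dist (est n ω) θ})
        Filter.atTop (nhds 0)) :
    ∀ θ₁ θ₂ : Θ, θ₁ ≠ θ₂ → ∀ K : ℕ, ∃ n ≥ K,
      Measure.map (est n) (P θ₁ n) ≠ Measure.map (est n) (P θ₂ n) := by
  intro θ₁ θ₂ hne K
  by_contra hcon
  push Not at hcon
  have hd : 0 < dist θ₁ θ₂ := dist_pos.mpr hne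
  have hε : 0 < dist θ₁ θ₂ / 3 := by positivity
  have hsum := (hconsistent θ₁ _ hε).add (hconsistent θ₂ _ hε)
  rw [add_zero] at hsum
  obtain ⟨n, hlt, hn⟩ := ((hsum.eventually (gt_mem_nhds (zero_lt_one' ENNReal))).and
    (Filter.eventually_ge_atTop K)).exists
  have hS : MeasurableSet {x : Θ | dist θ₁ θ₂ / 3 < dist x θ₁} :=
    (isOpen_lt continuous_const (continuous_id.dist continuous_const)).measurableSet
  have h1 : P θ₁ n {ω | dist θ₁ θ₂ / 3 < dist (est n ω) θ₁}
      = P θ₂ n {ω | dist θ₁ θ₂ / 3 < dist (est n ω) θ₁} := by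
    have h := congrArg (fun μ => μ {x : Θ | dist θ₁ θ₂ / 3 < dist x θ₁}) (hcon n hn)
    simp only [Measure.map_apply (hmeas n) hS] at h
    exact h
  rw [h1] at hlt
  have hcover : (Set.univ : Set (Ωn n)) ⊆ {ω | dist θ₁ θ₂ / 3 < dist (est n ω) θ₁} ∪
      {ω | dist θ₁ θ₂ / 3 < dist (est n ω) θ₂} := by
    intro ω _
    by_contra hω
    simp only [Set.mem_union, Set.mem_setOf_eq, not_or, not_lt] at hω
    have := dist_triangle_left θ₁ θ₂ (est n ω)
    linarith [hω.1, hω.2]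
  have h2 := (measure_mono (μ := P θ₂ n) hcover).trans (measure_union_le _ _)
  rw [measure_univ] at h2
  exact absurd hlt (not_lt.mpr h2)
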